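/- arXiv:1710.05318 — 9 statements merged into one kernel-verified Lean document; each statement's English description precedes it below -/
import Mathlib

section
/- L admits fiberwise derivative at every point w = (τ,0) with τ ∈ ℝ if and only if B is odd (B(−v) = −B(v) for all v ∈ V). In that case (∂L)_{(τ,0)}(ρ,v) = −2Λτρ + 2B(v)τ, and the map u ↦ (∂L)_w(u) is linear on ℝ × V for every w = (τ,0), τ ∈ ℝ, if and only if B is linear. -/
section PositivelyHomogeneous

variable {V : Type*} [AddCommGroup V] [Module ℝ V] {f : V → ℝ}

theorem map_zero_of_posHomogeneous (hf : ∀ l : ℝ, 0 < l → ∀ v, f (l • v) = l * f v) :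
    f 0 = 0 := by
  have h := hf 2 two_pos 0
  rw [smul_zero] at h
  linarith

theorem map_smul_of_posHomogeneous_of_nonneg
    (hf : ∀ l : ℝ, 0 < l → ∀ v, f (l • v) = l * f v) {l : ℝ} (hl : 0 ≤ l) (v : V) :
    f (l • v) = l * f v := by
  rcases hl.eq_or_lt with rfl | hl
  · rw [zero_smul, zero_mul, map_zero_of_posHomogeneous hf]
  · exact hf l hl v

theorem map_smul_of_posHomogeneous_of_nonpos
    (hf : ∀ l : ℝ, 0 < l → ∀ v, f (l • v) = l * f v) {l : ℝ} (hl : l ≤ 0) (v : V) :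
    f (l • v) = -l * f (-v) := by
  rw [← map_smul_of_posHomogeneous_of_nonneg hf (neg_nonneg.2 hl), neg_smul_neg]

theorem map_smul_of_posHomogeneous_of_odd
    (hf : ∀ l : ℝ, 0 < l → ∀ v, f (l • v) = l * f v) (hodd : ∀ v, f (-v) = -f v)
    (l : ℝ) (v : V) : f (l • v) = l * f v := by
  rcases le_total 0 l with hl | hl
  · exact map_smul_of_posHomogeneous_of_nonneg hf hl v
  · rw [map_smul_of_posHomogeneous_of_nonpos hf hl, hodd, neg_mul_neg]

theorem eq_of_hasDerivAt_smul_of_posHomogeneous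
    (hf : ∀ l : ℝ, 0 < l → ∀ v, f (l • v) = l * f v) {v : V} {d : ℝ}
    (hd : HasDerivAt (fun s : ℝ => f (s • v)) d 0) : d = f v := by
  have h : HasDerivWithinAt (fun s : ℝ => f (s • v)) (f v) (Set.Ici 0) 0 :=
    (hasDerivAt_mul_const (f v)).hasDerivWithinAt.congr
      (fun s hs => map_smul_of_posHomogeneous_of_nonneg hf hs v)
      (map_smul_of_posHomogeneous_of_nonneg hf le_rfl v)
  exact (uniqueDiffOn_Ici (0 : ℝ) 0 Set.self_mem_Ici).eq_deriv _ hd.hasDerivWithinAt h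

theorem map_neg_of_hasDerivAt_smul_of_posHomogeneous
    (hf : ∀ l : ℝ, 0 < l → ∀ v, f (l • v) = l * f v) {v : V} {d : ℝ}
    (hd : HasDerivAt (fun s : ℝ => f (s • v)) d 0) : f (-v) = -f v := by
  have hneg : HasDerivAt (fun s : ℝ => f (s • -v)) (-d) 0 := by
    have h := HasDerivAt.scomp (0 : ℝ) (h := fun s : ℝ => -s) (by simpa using hd)
      (hasDerivAt_neg (0 : ℝ))
    simpa [Function.comp_def] using h
  rw [← eq_of_hasDerivAt_smul_of_posHomogeneous hf hneg,
    eq_of_hasDerivAt_smul_of_posHomogeneous hf hd]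

theorem hasDerivAt_sq_smul_of_posHomogeneous
    (hf : ∀ l : ℝ, 0 < l → ∀ v, f (l • v) = l * f v) (v : V) :
    HasDerivAt (fun s : ℝ => f (s • v) ^ 2) 0 0 := by
  have hsq (c : ℝ) : HasDerivAt (fun s : ℝ => s ^ 2 * c) 0 0 := by
    simpa using (hasDerivAt_pow 2 (0 : ℝ)).mul_const c
  have hIic : HasDerivWithinAt (fun s : ℝ => f (s • v) ^ 2) 0 (Set.Iic 0) 0 :=
    (hsq (f (-v) ^ 2)).hasDerivWithinAt.congr_of_mem
      (fun s hs => by rw [map_smul_of_posHomogeneous_of_nonpos hf hs]; ring) Set.self_mem_Iic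
  have hIci : HasDerivWithinAt (fun s : ℝ => f (s • v) ^ 2) 0 (Set.Ici 0) 0 :=
    (hsq (f v ^ 2)).hasDerivWithinAt.congr_of_mem
      (fun s hs => by rw [map_smul_of_posHomogeneous_of_nonneg hf hs]; ring) Set.self_mem_Ici
  simpa [Set.Iic_union_Ici] using hIic.union hIci

end PositivelyHomogeneous

/-- for `L(τ,v) = −Λτ² + 2B(v)τ + F²(v)`, `L` admits fiberwise (two-sided
directional) derivatives at every `w = (τ,0)` iff `B` is odd; in that case the derivative
at `(τ,0)` in direction `(ρ,v)` equals `−2Λτρ + 2B(v)τ`, and this map is linear in the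
direction for every `τ` iff `B` is linear. -/
theorem fiberwise_derivative_on_T_iff_B_odd
    {V : Type*} [NormedAddCommGroup V] [NormedSpace ℝ V] [FiniteDimensional ℝ V]
    (Λ : ℝ) (hΛ : 0 < Λ) (B F : V → ℝ)
    (hBhom : ∀ l : ℝ, 0 < l → ∀ v, B (l • v) = l * B v)
    (hFnonneg : ∀ v, 0 ≤ F v)
    (hFhom : ∀ l : ℝ, 0 < l → ∀ v, F (l • v) = l * F v)
    (L : ℝ × V → ℝ)
    (hL : ∀ (τ : ℝ) (v : V), L (τ, v) = -Λ * τ ^ 2 + 2 * B v * τ + (F v) ^ 2) :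
    ((∀ (τ : ℝ) (u : ℝ × V), ∃ d : ℝ,
        HasDerivAt (fun s : ℝ => L ((τ, (0 : V)) + s • u)) d 0) ↔
      (∀ v : V, B (-v) = -B v)) ∧
    ((∀ v : V, B (-v) = -B v) →
      ((∀ (τ : ℝ) (u : ℝ × V),
          HasDerivAt (fun s : ℝ => L ((τ, (0 : V)) + s • u))
            (-2 * Λ * τ * u.1 + 2 * B u.2 * τ) 0) ∧
        ((∀ τ : ℝ, IsLinearMap ℝ (fun u : ℝ × V => -2 * Λ * τ * u.1 + 2 * B u.2 * τ)) ↔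
          IsLinearMap ℝ B))) := by
  have hLs (τ : ℝ) (u : ℝ × V) (s : ℝ) : L ((τ, (0 : V)) + s • u) =
      -Λ * (τ + s * u.1) ^ 2 + 2 * B (s • u.2) * (τ + s * u.1) + F (s • u.2) ^ 2 := by
    rw [← hL]
    congr 1
    ext <;> simp
  have hderiv (hodd : ∀ v : V, B (-v) = -B v) (τ : ℝ) (u : ℝ × V) :
      HasDerivAt (fun s : ℝ => L ((τ, (0 : V)) + s • u))
        (-2 * Λ * τ * u.1 + 2 * B u.2 * τ) 0 := by
    simp only [hLs, map_smul_of_posHomogeneous_of_odd hBhom hodd]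
    have hτ : HasDerivAt (fun s : ℝ => τ + s * u.1) u.1 0 :=
      (hasDerivAt_mul_const u.1).const_add τ
    have hB : HasDerivAt (fun s : ℝ => 2 * (s * B u.2)) (2 * B u.2) 0 :=
      (hasDerivAt_mul_const (B u.2)).const_mul 2
    refine ((((hτ.pow 2).const_mul (-Λ)).add (hB.mul hτ)).add
      (hasDerivAt_sq_smul_of_posHomogeneous hFhom u.2)).congr_deriv ?_
    simp
    ring
  refine ⟨⟨fun h v => ?_, fun hodd τ u => ⟨_, hderiv hodd τ u⟩⟩,
    fun hodd => ⟨hderiv hodd, fun h => ?_, fun h τ => ?_⟩⟩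
  · obtain ⟨d, hd⟩ := h 1 (0, v)
    have hB : HasDerivAt (fun s : ℝ => B (s • v)) ((d - 0) / 2) 0 := by
      refine (((hd.sub (hasDerivAt_sq_smul_of_posHomogeneous hFhom v)).add_const Λ).div_const
        2).congr_of_eventuallyEq (.of_forall fun s => ?_)
      simp only [Pi.sub_apply, hLs]
      ring
    exact map_neg_of_hasDerivAt_smul_of_posHomogeneous hBhom hB
  · refine ⟨fun v w => ?_, map_smul_of_posHomogeneous_of_odd hBhom hodd⟩
    have hadd := (h 1).map_add (0, v) (0, w)
    simp only [Prod.mk_add_mk, add_zero, mul_zero, zero_add, mul_one] at hadd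
    linarith
  · constructor
    · intro u w
      simp only [Prod.fst_add, Prod.snd_add, h.map_add]
      ring
    · intro c u
      simp only [Prod.smul_fst, Prod.smul_snd, h.map_smul, smul_eq_mul]
      ring
end

section
/- If (∂²B)_v is positive semi-definite for some v ≠ 0, then for every τ ≥ 0 the fiberwise Hessian g̃_{(τ,v)} is nondegenerate and has index 1 on ℝ × V. Likewise, if (∂²B)_v is negative semi-definite for some v ≠ 0, then g̃_{(τ,v)} has index 1 for every τ ≤ 0. -/
/-- A subspace on which the bilinear form `b` is negative definite. -/
def IsNegDefOn {E : Type*} [AddCommGroup E] [Module ℝ E]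
    (b : E → E → ℝ) (W : Submodule ℝ E) : Prop :=
  ∀ p ∈ W, p ≠ 0 → b p p < 0

/-- `b` is nondegenerate and the maximal dimension of a subspace on which it is
negative definite equals `1`. -/
def HasIndexOne {E : Type*} [AddCommGroup E] [Module ℝ E] (b : E → E → ℝ) : Prop :=
  (∀ p, (∀ q, b p q = 0) → p = 0) ∧
    (∃ W : Submodule ℝ E, IsNegDefOn b W ∧ Module.finrank ℝ W = 1) ∧
    ∀ W : Submodule ℝ E, IsNegDefOn b W → Module.finrank ℝ W ≤ 1

/-- The fiberwise Hessian of `L(τ,v) = −Λτ² + 2B(v)τ + F²(v)` at `(τ,v)`, `v ≠ 0`: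
`g̃((s,u),(s',u')) = −Λ s s' + (∂B)_v(u) s' + (∂B)_v(u') s + τ (∂²B)_v(u,u') + g_v(u,u')`. -/
noncomputable def gtilde {V : Type*} [NormedAddCommGroup V] [NormedSpace ℝ V]
    (Λ : ℝ) (B' : V → V →L[ℝ] ℝ) (B'' : V → V →L[ℝ] V →L[ℝ] ℝ)
    (g : V → V →L[ℝ] V →L[ℝ] ℝ) (τ : ℝ) (v : V) (p q : ℝ × V) : ℝ :=
  -Λ * p.1 * q.1 + B' v p.2 * q.1 + B' v q.2 * p.1 + τ * B'' v p.2 q.2 + g v p.2 q.2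

/-- A bilinear form on `ℝ × V` that is negative definite on `ℝ × 0` and positive definite on `0 × V`
has index `1`. -/
theorem hasIndexOne_of_posDef {V : Type*} [AddCommGroup V] [Module ℝ V]
    {Λ : ℝ} (hΛ : 0 < Λ) (l : V →ₗ[ℝ] ℝ) (h : V →ₗ[ℝ] V →ₗ[ℝ] ℝ)
    (hpos : ∀ u, u ≠ 0 → 0 < h u u) :
    HasIndexOne fun p q : ℝ × V =>
      -Λ * p.1 * q.1 + l p.2 * q.1 + l q.2 * p.1 + h p.2 q.2 := by
  refine ⟨?_, ⟨ℝ ∙ ((1, 0) : ℝ × V), ?_, ?_⟩, ?_⟩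
  · rintro ⟨s, u⟩ hp
    have key : Λ * s ^ 2 + h u u = 0 := by
      have := hp (-s, u)
      simp only at this
      linarith
    have hu : u = 0 := by
      by_contra hu
      have := hpos u hu
      have : 0 ≤ Λ * s ^ 2 := by positivity
      linarith
    subst hu
    have hs : s = 0 := by simpa [hΛ.ne'] using key
    simp [hs]
  · intro p hp hp0
    obtain ⟨c, rfl⟩ := Submodule.mem_span_singleton.1 hp
    have hc : c ≠ 0 := by
      rintro rfl
      simp at hp0
    have : 0 < Λ * (c * c) := mul_pos hΛ (mul_self_pos.2 hc)
    simp only [Prod.smul_mk, smul_eq_mul, mul_one, smul_zero, map_zero, zero_mul, add_zero]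
    linarith
  · exact finrank_span_singleton (by simp)
  · intro W hW
    have hinj : Function.Injective ((LinearMap.fst ℝ ℝ V).comp W.subtype) := by
      rw [← LinearMap.ker_eq_bot, LinearMap.ker_eq_bot']
      rintro ⟨⟨s, u⟩, hp⟩ hs
      obtain rfl : s = 0 := hs
      by_contra hne
      have hu : u ≠ 0 := by
        rintro rfl
        exact hne rfl
      have hneg := hW (0, u) hp (by simpa using hu)
      simp only [mul_zero, add_zero, zero_add] at hneg
      exact lt_asymm hneg (hpos u hu)
    simpa using LinearMap.finrank_le_finrank_of_injective hinj

/-- `g̃_{(τ,v)}` has index `1` as soon as `τ (∂²B)_v` is positive semi-definite and `g_v` is positive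
definite. -/
theorem hasIndexOne_gtilde {V : Type*} [NormedAddCommGroup V] [NormedSpace ℝ V]
    {Λ : ℝ} (hΛ : 0 < Λ) (B' : V → V →L[ℝ] ℝ) (B'' g : V → V →L[ℝ] V →L[ℝ] ℝ) {τ : ℝ} {v : V}
    (hB : ∀ u, 0 ≤ τ * B'' v u u) (hg : ∀ u, u ≠ 0 → 0 < g v u u) :
    HasIndexOne (gtilde Λ B' B'' g τ v) := by
  have := hasIndexOne_of_posDef hΛ (B' v).toLinearMap
    (τ • (B'' v).toLinearMap₁₂ + (g v).toLinearMap₁₂)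
    fun u hu => add_pos_of_nonneg_of_pos (hB u) (hg u hu)
  convert this using 3 with p q
  simp [gtilde, add_assoc]

/-- if `(∂²B)_v` is positive (resp. negative) semi-definite at `v ≠ 0`,
then the fiberwise Hessian `g̃_{(τ,v)}` has index 1 for every `τ ≥ 0` (resp. `τ ≤ 0`). -/
theorem index_one_of_semidefinite_hessian_of_B
    {V : Type*} [NormedAddCommGroup V] [NormedSpace ℝ V] [FiniteDimensional ℝ V]
    (Λ : ℝ) (hΛ : 0 < Λ)
    (B : V → ℝ) (B' : V → V →L[ℝ] ℝ) (B'' : V → V →L[ℝ] V →L[ℝ] ℝ)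
    (hBcont : Continuous B)
    (hBhom : ∀ l : ℝ, 0 < l → ∀ v, B (l • v) = l * B v)
    (hB' : ∀ v : V, v ≠ 0 → HasFDerivAt B (B' v) v)
    (hB'' : ∀ v : V, v ≠ 0 → HasFDerivAt B' (B'' v) v)
    (hB''cont : ContinuousOn B'' {0}ᶜ)
    (hB''symm : ∀ v : V, v ≠ 0 → ∀ u w : V, B'' v u w = B'' v w u)
    (F : V → ℝ) (F2' : V → V →L[ℝ] ℝ) (g : V → V →L[ℝ] V →L[ℝ] ℝ)
    (hFcont : Continuous F) (hFnonneg : ∀ v, 0 ≤ F v)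
    (hFhom : ∀ l : ℝ, 0 < l → ∀ v, F (l • v) = l * F v)
    (hFpos : ∀ v : V, v ≠ 0 → 0 < F v)
    (hF2' : ∀ v : V, v ≠ 0 → HasFDerivAt (fun w => (F w) ^ 2) (F2' v) v)
    (hg : ∀ v : V, v ≠ 0 → HasFDerivAt F2' ((2 : ℝ) • g v) v)
    (hgcont : ContinuousOn g {0}ᶜ)
    (hgsymm : ∀ v : V, v ≠ 0 → ∀ u w : V, g v u w = g v w u)
    (hgpos : ∀ v : V, v ≠ 0 → ∀ u : V, u ≠ 0 → 0 < g v u u)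
    :
    ∀ v : V, v ≠ 0 →
      ((∀ u : V, 0 ≤ B'' v u u) →
        ∀ τ : ℝ, 0 ≤ τ → HasIndexOne (gtilde Λ B' B'' g τ v)) ∧
      ((∀ u : V, B'' v u u ≤ 0) →
        ∀ τ : ℝ, τ ≤ 0 → HasIndexOne (gtilde Λ B' B'' g τ v)) := by
  intro v hv
  exact ⟨fun h τ hτ => hasIndexOne_gtilde hΛ B' B'' g (fun u => mul_nonneg hτ (h u)) (hgpos v hv),
    fun h τ hτ => hasIndexOne_gtilde hΛ B' B'' g
      (fun u => mul_nonneg_of_nonpos_of_nonpos hτ (h u)) (hgpos v hv)⟩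
end

section
/- Fix v ≠ 0. If there exists τ̄ > 0 such that for every τ > τ̄ the fiberwise Hessian g̃_{(τ,v)} is nondegenerate and has index 1, then (∂²B)_v is positive semi-definite. Similarly, if there exists τ̄ < 0 such that g̃_{(τ,v)} has index 1 for every τ < τ̄, then (∂²B)_v is negative semi-definite. -/
/-- If `g̃_{(τ,v)}` has index one then, since `(1,0)` is a negative vector, the form is nonnegative
on the component of `(0,u)` orthogonal to `(1,0)`. -/
theorem HasIndexOne.schur_complement_nonneg
    {V : Type*} [NormedAddCommGroup V] [NormedSpace ℝ V]
    {Λ : ℝ} (hΛ : 0 < Λ) {B' : V → V →L[ℝ] ℝ} {B'' g : V → V →L[ℝ] V →L[ℝ] ℝ} {τ : ℝ} {v : V}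
    (h : HasIndexOne (gtilde Λ B' B'' g τ v)) (u : V) :
    0 ≤ (B' v u) ^ 2 / Λ + τ * B'' v u u + g v u u := by
  by_contra! hneg
  have hu : u ≠ 0 := by
    rintro rfl
    simp at hneg
  let f : ℝ × ℝ →ₗ[ℝ] ℝ × V := LinearMap.id.prodMap (LinearMap.toSpanSingleton ℝ V u)
  have hf : Function.Injective f :=
    Function.injective_id.prodMap (smul_left_injective ℝ hu)
  have hW : IsNegDefOn (gtilde Λ B' B'' g τ v) (LinearMap.range f) := by
    rintro _ ⟨⟨s, b⟩, rfl⟩ hne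
    have hval : gtilde Λ B' B'' g τ v (f (s, b)) (f (s, b)) =
        -(Λ * (s - b * B' v u / Λ) ^ 2) +
          b ^ 2 * ((B' v u) ^ 2 / Λ + τ * B'' v u u + g v u u) := by
      simp only [gtilde, f, LinearMap.prodMap_apply, LinearMap.id_apply,
        LinearMap.toSpanSingleton_apply, map_smul, smul_apply, smul_eq_mul]
      field_simp
      ring
    rw [hval]
    rcases eq_or_ne b 0 with rfl | hb
    · have hs : s ≠ 0 := by
        rintro rfl
        exact hne (map_zero f)
      have : 0 < Λ * s ^ 2 := by positivity
      simpa using this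
    · have h₁ := mul_neg_of_pos_of_neg (by positivity : 0 < b ^ 2) hneg
      have h₂ : 0 ≤ Λ * (s - b * B' v u / Λ) ^ 2 := by positivity
      linarith
  have hle := h.2.2 _ hW
  rw [LinearMap.finrank_range_of_inj hf, Module.finrank_prod, Module.finrank_self] at hle
  omega

/-- An affine function that is nonnegative near `+∞` has nonnegative slope. -/
theorem slope_nonneg_of_forall_gt {a c t : ℝ} (h : ∀ x, t < x → 0 ≤ c + x * a) : 0 ≤ a := by
  by_contra! ha
  have hx := h (max t (-c / a) + 1) (by linarith [le_max_left t (-c / a)])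
  have hlt : -c / a < max t (-c / a) + 1 := by linarith [le_max_right t (-c / a)]
  rw [div_lt_iff_of_neg ha] at hlt
  linarith

/-- if `g̃_{(τ,v)}` has index 1 for all `τ` beyond some `τ̄ > 0` (resp.
below some `τ̄ < 0`), then `(∂²B)_v` is positive (resp. negative) semi-definite. -/
theorem semidefinite_hessian_of_B_of_index_one
    {V : Type*} [NormedAddCommGroup V] [NormedSpace ℝ V] [FiniteDimensional ℝ V]
    (Λ : ℝ) (hΛ : 0 < Λ)
    (B : V → ℝ) (B' : V → V →L[ℝ] ℝ) (B'' : V → V →L[ℝ] V →L[ℝ] ℝ)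
    (hBcont : Continuous B)
    (hBhom : ∀ l : ℝ, 0 < l → ∀ v, B (l • v) = l * B v)
    (hB' : ∀ v : V, v ≠ 0 → HasFDerivAt B (B' v) v)
    (hB'' : ∀ v : V, v ≠ 0 → HasFDerivAt B' (B'' v) v)
    (hB''cont : ContinuousOn B'' {0}ᶜ)
    (hB''symm : ∀ v : V, v ≠ 0 → ∀ u w : V, B'' v u w = B'' v w u)
    (F : V → ℝ) (F2' : V → V →L[ℝ] ℝ) (g : V → V →L[ℝ] V →L[ℝ] ℝ)
    (hFcont : Continuous F) (hFnonneg : ∀ v, 0 ≤ F v)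
    (hFhom : ∀ l : ℝ, 0 < l → ∀ v, F (l • v) = l * F v)
    (hFpos : ∀ v : V, v ≠ 0 → 0 < F v)
    (hF2' : ∀ v : V, v ≠ 0 → HasFDerivAt (fun w => (F w) ^ 2) (F2' v) v)
    (hg : ∀ v : V, v ≠ 0 → HasFDerivAt F2' ((2 : ℝ) • g v) v)
    (hgcont : ContinuousOn g {0}ᶜ)
    (hgsymm : ∀ v : V, v ≠ 0 → ∀ u w : V, g v u w = g v w u)
    (hgpos : ∀ v : V, v ≠ 0 → ∀ u : V, u ≠ 0 → 0 < g v u u)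
    :
    ∀ v : V, v ≠ 0 →
      ((∃ τbar : ℝ, 0 < τbar ∧
          ∀ τ : ℝ, τbar < τ → HasIndexOne (gtilde Λ B' B'' g τ v)) →
        ∀ u : V, 0 ≤ B'' v u u) ∧
      ((∃ τbar : ℝ, τbar < 0 ∧
          ∀ τ : ℝ, τ < τbar → HasIndexOne (gtilde Λ B' B'' g τ v)) →
        ∀ u : V, B'' v u u ≤ 0) := by
  rintro v -
  refine ⟨?_, ?_⟩
  · rintro ⟨t, -, h⟩ u
    refine slope_nonneg_of_forall_gt (c := (B' v u) ^ 2 / Λ + g v u u) (t := t) fun x hx => ?_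
    linarith [(h x hx).schur_complement_nonneg hΛ u]
  · rintro ⟨t, -, h⟩ u
    refine neg_nonneg.mp <|
      slope_nonneg_of_forall_gt (c := (B' v u) ^ 2 / Λ + g v u u) (t := -t) fun x hx => ?_
    linarith [(h (-x) (by linarith)).schur_complement_nonneg hΛ u]
end

section
/- If B = ω + F₁, where ω ∈ V* is a linear form and F₁ : V → [0,∞) is continuous, positively homogeneous of degree 1, twice continuously differentiable on V ∖ {0}, with second derivative (∂²F₁)_v positive semi-definite for every v ≠ 0, then the fiberwise Hessian g̃_{(τ,v)} is nondegenerate and has index 1 for every v ∈ V ∖ {0} and every τ > 0. If instead B = ω − F₁, then g̃_{(τ,v)} has index 1 for every v ≠ 0 and every τ < 0. -/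
/-- If `τ B''_v + g_v` is positive definite, then `g̃_{(τ,v)}` has index 1. -/
theorem hasIndexOne_gtilde_of_pos {V : Type*} [NormedAddCommGroup V] [NormedSpace ℝ V]
    {Λ : ℝ} (hΛ : 0 < Λ) {B' : V → V →L[ℝ] ℝ} {B'' g : V → V →L[ℝ] V →L[ℝ] ℝ} {τ : ℝ} {v : V}
    (hpos : ∀ u : V, u ≠ 0 → 0 < τ * B'' v u u + g v u u) :
    HasIndexOne (gtilde Λ B' B'' g τ v) := by
  refine ⟨?_, ⟨ℝ ∙ ((1, 0) : ℝ × V), ?_, finrank_span_singleton (by simp)⟩, ?_⟩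
  · rintro ⟨s, u⟩ h
    have h₁ : -Λ * s + B' v u = 0 := by simpa [gtilde] using h (1, 0)
    have h₂ : B' v u * s + τ * B'' v u u + g v u u = 0 := by simpa [gtilde] using h (0, u)
    have hu : u = 0 := by
      by_contra hu
      have := hpos u hu
      rw [show B' v u = Λ * s by linarith] at h₂
      nlinarith [mul_nonneg hΛ.le (sq_nonneg s)]
    subst hu
    have hs : s = 0 := by simpa [hΛ.ne'] using h₁
    simp [hs]
  · intro p hp hp0
    obtain ⟨a, rfl⟩ := Submodule.mem_span_singleton.mp hp
    have ha : a ≠ 0 := by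
      rintro rfl
      simp at hp0
    have := mul_pos hΛ (mul_self_pos.mpr ha)
    simp only [gtilde, Prod.smul_mk, smul_eq_mul, mul_one, smul_zero, map_zero, zero_mul,
      mul_zero, add_zero]
    linarith
  · intro W hW
    have hinj : Function.Injective ((LinearMap.fst ℝ ℝ V).domRestrict W) := by
      rw [← LinearMap.ker_eq_bot, LinearMap.ker_eq_bot']
      rintro ⟨⟨s, u⟩, hp⟩ hs
      obtain rfl : s = 0 := hs
      by_contra hne
      have hu : u ≠ 0 := by
        rintro rfl
        exact hne rfl
      have h₁ := hW (0, u) hp (by simpa using hu)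
      have h₂ := hpos u hu
      simp only [gtilde, mul_zero, add_zero, zero_add] at h₁
      linarith
    simpa using LinearMap.finrank_le_finrank_of_injective hinj

/-- If `B = ω + c F₁` with `ω` linear, then `B'' = c F₁''` away from the origin. -/
theorem second_fderiv_eq_of_eq_linear_add_smul
    {V : Type*} [NormedAddCommGroup V] [NormedSpace ℝ V]
    {B F₁ : V → ℝ} {B' F₁' : V → V →L[ℝ] ℝ} {B'' F₁'' : V → V →L[ℝ] V →L[ℝ] ℝ}
    (ω : V →L[ℝ] ℝ) (c : ℝ)
    (hB' : ∀ v : V, v ≠ 0 → HasFDerivAt B (B' v) v)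
    (hB'' : ∀ v : V, v ≠ 0 → HasFDerivAt B' (B'' v) v)
    (hF₁' : ∀ v : V, v ≠ 0 → HasFDerivAt F₁ (F₁' v) v)
    (hF₁'' : ∀ v : V, v ≠ 0 → HasFDerivAt F₁' (F₁'' v) v)
    (hB : ∀ v : V, B v = ω v + c * F₁ v) {v : V} (hv : v ≠ 0) :
    B'' v = c • F₁'' v := by
  have hfst : ∀ w : V, w ≠ 0 → B' w = ω + c • F₁' w := fun w hw ↦
    (hB' w hw).unique <| funext hB ▸ ω.hasFDerivAt.add ((hF₁' w hw).const_mul c)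
  have hev : B' =ᶠ[nhds v] fun w ↦ ω + c • F₁' w :=
    Filter.mem_of_superset (isOpen_ne.mem_nhds hv) hfst
  exact (hB'' v hv).unique
    ((((hF₁'' v hv).const_smul c).const_add ω).congr_of_eventuallyEq hev)

/-- if `B = ω + F₁` (resp. `B = ω − F₁`) with `ω` linear and `F₁` a
nonnegative 1-homogeneous function with positive semi-definite fiberwise Hessian, then
`g̃_{(τ,v)}` has index 1 for every `v ≠ 0` and every `τ > 0` (resp. `τ < 0`). -/
theorem index_one_of_randers_type_B
    {V : Type*} [NormedAddCommGroup V] [NormedSpace ℝ V] [FiniteDimensional ℝ V]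
    (Λ : ℝ) (hΛ : 0 < Λ)
    (B : V → ℝ) (B' : V → V →L[ℝ] ℝ) (B'' : V → V →L[ℝ] V →L[ℝ] ℝ)
    (hBcont : Continuous B)
    (hBhom : ∀ l : ℝ, 0 < l → ∀ v, B (l • v) = l * B v)
    (hB' : ∀ v : V, v ≠ 0 → HasFDerivAt B (B' v) v)
    (hB'' : ∀ v : V, v ≠ 0 → HasFDerivAt B' (B'' v) v)
    (hB''cont : ContinuousOn B'' {0}ᶜ)
    (hB''symm : ∀ v : V, v ≠ 0 → ∀ u w : V, B'' v u w = B'' v w u)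
    (F : V → ℝ) (F2' : V → V →L[ℝ] ℝ) (g : V → V →L[ℝ] V →L[ℝ] ℝ)
    (hFcont : Continuous F) (hFnonneg : ∀ v, 0 ≤ F v)
    (hFhom : ∀ l : ℝ, 0 < l → ∀ v, F (l • v) = l * F v)
    (hFpos : ∀ v : V, v ≠ 0 → 0 < F v)
    (hF2' : ∀ v : V, v ≠ 0 → HasFDerivAt (fun w => (F w) ^ 2) (F2' v) v)
    (hg : ∀ v : V, v ≠ 0 → HasFDerivAt F2' ((2 : ℝ) • g v) v)
    (hgcont : ContinuousOn g {0}ᶜ)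
    (hgsymm : ∀ v : V, v ≠ 0 → ∀ u w : V, g v u w = g v w u)
    (hgpos : ∀ v : V, v ≠ 0 → ∀ u : V, u ≠ 0 → 0 < g v u u)
    (ω : V →L[ℝ] ℝ) (F₁ : V → ℝ) (F₁' : V → V →L[ℝ] ℝ) (F₁'' : V → V →L[ℝ] V →L[ℝ] ℝ)
    (hF₁cont : Continuous F₁) (hF₁nonneg : ∀ v, 0 ≤ F₁ v)
    (hF₁hom : ∀ l : ℝ, 0 < l → ∀ v, F₁ (l • v) = l * F₁ v)
    (hF₁' : ∀ v : V, v ≠ 0 → HasFDerivAt F₁ (F₁' v) v)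
    (hF₁'' : ∀ v : V, v ≠ 0 → HasFDerivAt F₁' (F₁'' v) v)
    (hF₁''cont : ContinuousOn F₁'' {0}ᶜ)
    (hF₁psd : ∀ v : V, v ≠ 0 → ∀ u : V, 0 ≤ F₁'' v u u) :
    ((∀ v : V, B v = ω v + F₁ v) →
      ∀ v : V, v ≠ 0 → ∀ τ : ℝ, 0 < τ → HasIndexOne (gtilde Λ B' B'' g τ v)) ∧
    ((∀ v : V, B v = ω v - F₁ v) →
      ∀ v : V, v ≠ 0 → ∀ τ : ℝ, τ < 0 → HasIndexOne (gtilde Λ B' B'' g τ v)) := by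
  have key : ∀ c : ℝ, (∀ v, B v = ω v + c * F₁ v) → ∀ v : V, v ≠ 0 → ∀ τ : ℝ, 0 ≤ τ * c →
      HasIndexOne (gtilde Λ B' B'' g τ v) := by
    intro c hB v hv τ hτ
    refine hasIndexOne_gtilde_of_pos hΛ fun u hu ↦ ?_
    rw [second_fderiv_eq_of_eq_linear_add_smul ω c hB' hB'' hF₁' hF₁'' hB hv]
    simp only [smul_apply, smul_eq_mul, ← mul_assoc]
    exact add_pos_of_nonneg_of_pos (mul_nonneg hτ (hF₁psd v hv u)) (hgpos v hv u hu)
  refine ⟨fun hB v hv τ hτ ↦ key 1 (fun w ↦ ?_) v hv τ (by linarith),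
    fun hB v hv τ hτ ↦ key (-1) (fun w ↦ ?_) v hv τ (by linarith)⟩
  · rw [hB, one_mul]
  · rw [hB]
    ring
end

section
/- For every w ∈ V one has B̃(w) = ½(L(w + K) − L(w) − L(K)) = λ_w·L(K); in particular B̃ is a linear form on V. Moreover, L(w + τK) = L(w) + τ²L(K) + 2τB̃(w) for all w ∈ V and all τ ∈ ℝ. -/
/-- A positively 2-homogeneous function that is additive along `±K` on the scaling-stable set
`ker φ` is additive along the whole line `ℝ K` there. -/
theorem apply_add_smul_of_two_homogeneous {V : Type*} [AddCommGroup V] [Module ℝ V]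
    {L : V → ℝ} (hhom : ∀ l : ℝ, 0 < l → ∀ w : V, L (l • w) = l ^ 2 * L w)
    {K : V} (φ : V →ₗ[ℝ] ℝ)
    (hc : ∀ w : V, φ w = 0 → L (w + K) = L w + L K ∧ L (w - K) = L w + L K)
    {w : V} (hw : φ w = 0) (l : ℝ) : L (w + l • K) = L w + l ^ 2 * L K := by
  have hker (c : ℝ) : φ (c • w) = 0 := by simp [hw]
  rcases lt_trichotomy l 0 with hl | rfl | hl
  · have hw' : w = (-l) • ((-l)⁻¹ • w) := (smul_inv_smul₀ (by linarith) w).symm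
    have h : w + l • K = (-l) • ((-l)⁻¹ • w - K) := by
      rw [smul_sub, ← hw', neg_smul, sub_neg_eq_add]
    rw [h, hhom _ (by linarith), (hc _ (hker _)).2, mul_add, ← hhom _ (by linarith), ← hw', neg_sq]
  · simp
  · have hw' : w = l • (l⁻¹ • w) := (smul_inv_smul₀ hl.ne' w).symm
    have h : w + l • K = l • (l⁻¹ • w + K) := by rw [smul_add, ← hw']
    rw [h, hhom _ hl, (hc _ (hker _)).1, mul_add, ← hhom _ hl, ← hw']

/-- for a `C¹`, positively 2-homogeneous `L` with a timelike `K`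
(`L(K) < 0`) satisfying `L(K) = L(−K)` and `L(w ± K) = L(w) + L(K)` on
`D := ker dL_K`, the function `B̃(w) := ½ dL_w(K)` satisfies
`B̃(w) = ½(L(w+K) − L(w) − L(K)) = λ_w L(K)` (where `w = w_D + λ_w K`, `w_D ∈ D`),
is a linear form, and `L(w + τK) = L(w) + τ²L(K) + 2τB̃(w)` for all `w ∈ V`, `τ ∈ ℝ`. -/
theorem btilde_linear_form
    {V : Type*} [NormedAddCommGroup V] [NormedSpace ℝ V] [FiniteDimensional ℝ V]
    (L : V → ℝ) (hL : ContDiff ℝ 1 L)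
    (hhom : ∀ l : ℝ, 0 < l → ∀ w : V, L (l • w) = l ^ 2 * L w)
    (K : V) (hK : L K < 0)
    (hb : L K = L (-K))
    (hc : ∀ w : V, fderiv ℝ L K w = 0 →
      L (w + K) = L w + L K ∧ L (w - K) = L w + L K)
    (Btilde : V → ℝ) (hBt : ∀ w : V, Btilde w = (1 / 2) * fderiv ℝ L w K) :
    (∀ (w wD : V) (lw : ℝ), fderiv ℝ L K wD = 0 → w = wD + lw • K →
      Btilde w = (1 / 2) * (L (w + K) - L w - L K) ∧ Btilde w = lw * L K) ∧
    IsLinearMap ℝ Btilde ∧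
    (∀ (w : V) (τ : ℝ), L (w + τ • K) = L w + τ ^ 2 * L K + 2 * τ * Btilde w) := by
  have hline {w : V} (hw : fderiv ℝ L K w = 0) (l : ℝ) :
      L (w + l • K) = L w + l ^ 2 * L K :=
    apply_add_smul_of_two_homogeneous hhom (fderiv ℝ L K).toLinearMap hc hw l
  have hB {w : V} (hw : fderiv ℝ L K w = 0) (l : ℝ) : Btilde (w + l • K) = l * L K := by
    have hcurve : HasDerivAt (fun t : ℝ => w + t • K) K l := by
      simpa using ((hasDerivAt_id l).smul_const K).const_add w
    have hcomp : HasDerivAt (fun t : ℝ => L (w + t • K)) (fderiv ℝ L (w + l • K) K) l :=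
      ((hL.differentiable one_ne_zero) (w + l • K)).hasFDerivAt.comp_hasDerivAt l hcurve
    have hpoly : HasDerivAt (fun t : ℝ => L (w + t • K)) (2 * l * L K) l := by
      simp only [hline hw]
      simpa using (((hasDerivAt_id l).pow 2).mul_const (L K)).const_add (L w)
    rw [hBt, hcomp.unique hpoly]
    ring
  have hKK : fderiv ℝ L K K = 2 * L K := by
    have h := hB (map_zero (fderiv ℝ L K)) 1
    rw [one_smul, zero_add, hBt] at h
    linarith
  have hdecomp (w : V) : ∃ (wD : V) (l : ℝ), fderiv ℝ L K wD = 0 ∧ w = wD + l • K ∧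
      l * L K = (1 / 2) * fderiv ℝ L K w := by
    have hne := hK.ne
    refine ⟨w - (fderiv ℝ L K w / (2 * L K)) • K, fderiv ℝ L K w / (2 * L K), ?_, by simp, ?_⟩
    · rw [map_sub, map_smul, hKK, smul_eq_mul]
      field_simp
      ring
    · field_simp
  have hBlin (w : V) : Btilde w = (1 / 2) * fderiv ℝ L K w := by
    obtain ⟨wD, l, hD, hw, hl⟩ := hdecomp w
    rw [← hl, hw, hB hD]
  have hexp (w : V) (τ : ℝ) : L (w + τ • K) = L w + τ ^ 2 * L K + 2 * τ * Btilde w := by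
    obtain ⟨wD, l, hD, rfl, -⟩ := hdecomp w
    rw [add_assoc, ← add_smul, hline hD, hline hD, hB hD]
    ring
  refine ⟨fun w wD l hD hw => ⟨?_, hw ▸ hB hD l⟩, ⟨fun x y => ?_, fun c x => ?_⟩, hexp⟩
  · have h := hexp w 1
    rw [one_smul] at h
    linarith
  · simp only [hBlin, map_add]
    ring
  · simp only [hBlin, map_smul, smul_eq_mul]
    ring
end

section
/- For every w ∈ V ∖ ℝK (so that w_D ≠ 0) one has: g̃_w(u,u) = g̃_{w_D}(u,u) for every u ∈ D; g̃_w(K,K) = L(K); and g̃_w(u,K) = λ_u·L(K) for every u ∈ V, where u = u_D + λ_u K with u_D ∈ D. -/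
/-- The fiberwise second variation
`g̃_w(u₁,u₂) := ½ ∂²/∂s₁∂s₂ L(w + s₁u₁ + s₂u₂)|_{(0,0)}`. -/
noncomputable def secondVar {V : Type*} [NormedAddCommGroup V] [NormedSpace ℝ V]
    (L : V → ℝ) (w u₁ u₂ : V) : ℝ :=
  (1 / 2) * deriv (fun s₁ : ℝ => deriv (fun s₂ : ℝ => L (w + s₁ • u₁ + s₂ • u₂)) 0) 0

/-- Euler's identity for positively homogeneous functions of degree two. -/
theorem fderiv_apply_self_of_sq_homogeneous
    {V : Type*} [NormedAddCommGroup V] [NormedSpace ℝ V] {L : V → ℝ}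
    (hhom : ∀ l : ℝ, 0 < l → ∀ w : V, L (l • w) = l ^ 2 * L w)
    {K : V} (hL : DifferentiableAt ℝ L K) : fderiv ℝ L K K = 2 * L K := by
  have hline : HasDerivAt (fun l : ℝ => l • K) K 1 := by
    simpa using (hasDerivAt_id (1 : ℝ)).smul_const K
  have hcomp : HasDerivAt (fun l : ℝ => L (l • K)) (fderiv ℝ L K K) 1 :=
    HasFDerivAt.comp_hasDerivAt (1 : ℝ) (by simpa using hL.hasFDerivAt) hline
  have hsq : HasDerivAt (fun l : ℝ => l ^ 2 * L K) (2 * L K) 1 := by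
    simpa using (hasDerivAt_pow 2 (1 : ℝ)).mul_const (L K)
  refine hcomp.unique (hsq.congr_of_eventuallyEq ?_)
  filter_upwards [eventually_gt_nhds (zero_lt_one' ℝ)] with l hl using hhom l hl K

/-- A positively homogeneous function of degree two which is additive along `±K` on a subspace
splits off the quadratic term `t ^ 2 * L K`. -/
theorem sq_homogeneous_add_smul
    {V : Type*} [AddCommGroup V] [Module ℝ V] {L : V → ℝ}
    (hhom : ∀ l : ℝ, 0 < l → ∀ w : V, L (l • w) = l ^ 2 * L w)
    {K : V} {D : Submodule ℝ V}
    (hD : ∀ w ∈ D, L (w + K) = L w + L K ∧ L (w - K) = L w + L K)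
    {w : V} (hw : w ∈ D) (t : ℝ) : L (w + t • K) = L w + t ^ 2 * L K := by
  rcases lt_trichotomy t 0 with ht | rfl | ht
  · have hpos : 0 < -t := neg_pos.mpr ht
    have hsplit : w = (-t) • ((-t)⁻¹ • w) := (smul_inv_smul₀ hpos.ne' w).symm
    have hadd : w + t • K = (-t) • ((-t)⁻¹ • w - K) := by
      rw [smul_sub, ← hsplit, neg_smul, sub_neg_eq_add]
    rw [hadd, hhom _ hpos, (hD _ (D.smul_mem _ hw)).2, mul_add, ← hhom _ hpos, ← hsplit, neg_sq]
  · simp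
  · have hsplit : w = t • (t⁻¹ • w) := (smul_inv_smul₀ ht.ne' w).symm
    have hadd : w + t • K = t • (t⁻¹ • w + K) := by
      rw [smul_add, ← hsplit]
    rw [hadd, hhom _ ht, (hD _ (D.smul_mem _ hw)).1, mul_add, ← hhom _ ht, ← hsplit]

/-- The second variation in the directions `u` and `K` of a function that splits off the quadratic
term `t ^ 2 * L K`. -/
theorem secondVar_right_of_splits
    {V : Type*} [NormedAddCommGroup V] [NormedSpace ℝ V] {L : V → ℝ} {K : V} {D : Submodule ℝ V}
    (hsplit : ∀ w ∈ D, ∀ t : ℝ, L (w + t • K) = L w + t ^ 2 * L K)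
    {w u : V} (hw : w ∈ D) (hu : u ∈ D) (a b : ℝ) :
    secondVar L (w + a • K) (u + b • K) K = b * L K := by
  have hinner : ∀ s₁ : ℝ,
      deriv (fun s₂ : ℝ => L (w + a • K + s₁ • (u + b • K) + s₂ • K)) 0
        = 2 * (a + s₁ * b) * L K := by
    intro s₁
    have heq : (fun s₂ : ℝ => L (w + a • K + s₁ • (u + b • K) + s₂ • K))
        = fun s₂ => L (w + s₁ • u) + (a + s₁ * b + s₂) ^ 2 * L K := by
      funext s₂
      rw [← hsplit _ (D.add_mem hw (D.smul_mem s₁ hu))]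
      congr 1
      module
    have hder := (((hasDerivAt_id (0 : ℝ)).const_add (a + s₁ * b)).pow 2).mul_const (L K)
    rw [heq]
    simpa using (hder.const_add (L (w + s₁ • u))).deriv
  have houter : deriv (fun s₁ : ℝ => 2 * (a + s₁ * b) * L K) 0 = 2 * b * L K := by
    simp
  simp only [secondVar, hinner, houter]
  ring

/-- For a function that splits off the quadratic term `t ^ 2 * L K`, the second variation along
the complementary subspace does not depend on the `K`-component of the base point. -/
theorem secondVar_add_smul_of_splits
    {V : Type*} [NormedAddCommGroup V] [NormedSpace ℝ V] {L : V → ℝ} {K : V} {D : Submodule ℝ V}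
    (hsplit : ∀ w ∈ D, ∀ t : ℝ, L (w + t • K) = L w + t ^ 2 * L K)
    {w u₁ u₂ : V} (hw : w ∈ D) (hu₁ : u₁ ∈ D) (hu₂ : u₂ ∈ D) (a : ℝ) :
    secondVar L (w + a • K) u₁ u₂ = secondVar L w u₁ u₂ := by
  have heq : ∀ s₁ s₂ : ℝ,
      L (w + a • K + s₁ • u₁ + s₂ • u₂) = L (w + s₁ • u₁ + s₂ • u₂) + a ^ 2 * L K := by
    intro s₁ s₂
    rw [← hsplit _ (D.add_mem (D.add_mem hw (D.smul_mem s₁ hu₁)) (D.smul_mem s₂ hu₂))]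
    congr 1
    module
  simp only [secondVar, heq, deriv_add_const]

/-- for every `w ∉ ℝK` (writing `w = w_D + λ_w K` with `w_D ∈ D = ker dL_K`):
`g̃_w(u,u) = g̃_{w_D}(u,u)` for `u ∈ D`, `g̃_w(K,K) = L(K)`, and `g̃_w(u,K) = λ_u L(K)`
for every `u = u_D + λ_u K`. -/
theorem secondVar_splitting
    {V : Type*} [NormedAddCommGroup V] [NormedSpace ℝ V] [FiniteDimensional ℝ V]
    (L : V → ℝ) (hL : ContDiff ℝ 1 L)
    (hhom : ∀ l : ℝ, 0 < l → ∀ w : V, L (l • w) = l ^ 2 * L w)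
    (K : V) (hK : L K < 0)
    (hb : L K = L (-K))
    (hc : ∀ w : V, fderiv ℝ L K w = 0 →
      L (w + K) = L w + L K ∧ L (w - K) = L w + L K)
    (hC2 : ContDiffOn ℝ 2 L (((Submodule.span ℝ {K} : Submodule ℝ V) : Set V)ᶜ)) :
    ∀ w : V, w ∉ (Submodule.span ℝ {K} : Submodule ℝ V) →
      (∀ (wD : V) (lw : ℝ), fderiv ℝ L K wD = 0 → w = wD + lw • K →
        ∀ u : V, fderiv ℝ L K u = 0 → secondVar L w u u = secondVar L wD u u) ∧
      secondVar L w K K = L K ∧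
      (∀ (u uD : V) (lu : ℝ), fderiv ℝ L K uD = 0 → u = uD + lu • K →
        secondVar L w u K = lu * L K) := by
  intro w _
  let D : Submodule ℝ V := LinearMap.ker (fderiv ℝ L K : V →ₗ[ℝ] ℝ)
  have hsplit : ∀ w ∈ D, ∀ t : ℝ, L (w + t • K) = L w + t ^ 2 * L K :=
    fun _ hw t => sq_homogeneous_add_smul hhom (D := D) hc hw t
  have hKK : fderiv ℝ L K K ≠ 0 := by
    rw [fderiv_apply_self_of_sq_homogeneous hhom (hL.differentiable one_ne_zero K)]
    exact mul_ne_zero two_ne_zero hK.ne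
  obtain ⟨vD, hvD, a, rfl⟩ : ∃ vD ∈ D, ∃ a : ℝ, w = vD + a • K := by
    refine ⟨w - (fderiv ℝ L K w / fderiv ℝ L K K) • K, ?_, _, (sub_add_cancel _ _).symm⟩
    change fderiv ℝ L K (w - (fderiv ℝ L K w / fderiv ℝ L K K) • K) = 0
    rw [map_sub, map_smul, smul_eq_mul, div_mul_cancel₀ _ hKK, sub_self]
  refine ⟨?_, ?_, ?_⟩
  · intro wD lw hwD hw u hu
    rw [hw]
    exact secondVar_add_smul_of_splits (D := D) hsplit hwD hu hu lw
  · simpa using secondVar_right_of_splits hsplit hvD D.zero_mem a 1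
  · rintro _ uD lu huD rfl
    exact secondVar_right_of_splits (D := D) hsplit hvD huD a lu
end

section
/- Assume (∂²B)_v is positive semi-definite for every v ≠ 0, and that either B(v) ≥ 0 for all v ∈ V or B is linear. Then G := √(B² + ΛF²) is a Minkowski norm on V: G is continuous and nonnegative on V, positively homogeneous of degree 1, G(v) > 0 for every v ≠ 0, G is twice continuously differentiable on V ∖ {0}, and the second derivative of G² at every v ≠ 0 is a positive definite bilinear form on V. -/
/-- `G := √(B² + ΛF²)`. -/
noncomputable def Gfun {V : Type*} (Λ : ℝ) (B F : V → ℝ) (v : V) : ℝ :=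
  Real.sqrt ((B v) ^ 2 + Λ * (F v) ^ 2)

/-- A function with continuous first and second derivatives on an open set is `C²` there. -/
theorem contDiffOn_two_of_hasFDerivAt {E : Type*} [NormedAddCommGroup E] [NormedSpace ℝ E]
    {s : Set E} (hs : IsOpen s) {f : E → ℝ} {f' : E → E →L[ℝ] ℝ} {f'' : E → E →L[ℝ] E →L[ℝ] ℝ}
    (hf : ∀ x ∈ s, HasFDerivAt f (f' x) x) (hf' : ∀ x ∈ s, HasFDerivAt f' (f'' x) x)
    (hcont : ContinuousOn f'' s) : ContDiffOn ℝ 2 f s := by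
  have h1 : ContDiffOn ℝ 1 f' s := by
    rw [show (1 : WithTop ℕ∞) = 0 + 1 by norm_num, contDiffOn_succ_iff_fderiv_of_isOpen hs]
    refine ⟨fun x hx => (hf' x hx).differentiableAt.differentiableWithinAt, by simp, ?_⟩
    rw [contDiffOn_zero]
    exact hcont.congr fun x hx => (hf' x hx).fderiv
  rw [show (2 : WithTop ℕ∞) = 1 + 1 by norm_num, contDiffOn_succ_iff_fderiv_of_isOpen hs]
  exact ⟨fun x hx => (hf x hx).differentiableAt.differentiableWithinAt, by simp,
    h1.congr fun x hx => (hf x hx).fderiv⟩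

/-- The second derivative of a linear map vanishes away from the origin. -/
theorem IsLinearMap.second_fderiv_eq_zero {V : Type*} [NormedAddCommGroup V] [NormedSpace ℝ V]
    [FiniteDimensional ℝ V] {B : V → ℝ} (hB : IsLinearMap ℝ B) {B' : V → V →L[ℝ] ℝ}
    {B'' : V →L[ℝ] V →L[ℝ] ℝ} (hB' : ∀ v : V, v ≠ 0 → HasFDerivAt B (B' v) v)
    {v : V} (hv : v ≠ 0) (hB'' : HasFDerivAt B' B'' v) : B'' = 0 := by
  set L : V →L[ℝ] ℝ := LinearMap.toContinuousLinearMap (hB.mk' B)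
  have hL : ∀ w ≠ 0, B' w = L := fun w hw => (hB' w hw).unique L.hasFDerivAt
  have hev : B' =ᶠ[nhds v] fun _ => L := by
    filter_upwards [isOpen_ne.mem_nhds hv] with w hw using hL w hw
  exact hB''.unique ((hasFDerivAt_const L v).congr_of_eventuallyEq hev)

/-- if `(∂²B)_v` is positive semi-definite for every `v ≠ 0` and either
`B ≥ 0` or `B` is linear, then `G = √(B² + ΛF²)` is a Minkowski norm on `V`. -/
theorem G_is_minkowski_norm
    {V : Type*} [NormedAddCommGroup V] [NormedSpace ℝ V] [FiniteDimensional ℝ V]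
    (Λ : ℝ) (hΛ : 0 < Λ)
    (B : V → ℝ) (B' : V → V →L[ℝ] ℝ) (B'' : V → V →L[ℝ] V →L[ℝ] ℝ)
    (hBcont : Continuous B)
    (hBhom : ∀ l : ℝ, 0 < l → ∀ v, B (l • v) = l * B v)
    (hB' : ∀ v : V, v ≠ 0 → HasFDerivAt B (B' v) v)
    (hB'' : ∀ v : V, v ≠ 0 → HasFDerivAt B' (B'' v) v)
    (hB''cont : ContinuousOn B'' {0}ᶜ)
    (hB''symm : ∀ v : V, v ≠ 0 → ∀ u w : V, B'' v u w = B'' v w u)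
    (F : V → ℝ) (F2' : V → V →L[ℝ] ℝ) (g : V → V →L[ℝ] V →L[ℝ] ℝ)
    (hFcont : Continuous F) (hFnonneg : ∀ v, 0 ≤ F v)
    (hFhom : ∀ l : ℝ, 0 < l → ∀ v, F (l • v) = l * F v)
    (hFpos : ∀ v : V, v ≠ 0 → 0 < F v)
    (hF2' : ∀ v : V, v ≠ 0 → HasFDerivAt (fun w => (F w) ^ 2) (F2' v) v)
    (hg : ∀ v : V, v ≠ 0 → HasFDerivAt F2' ((2 : ℝ) • g v) v)
    (hgcont : ContinuousOn g {0}ᶜ)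
    (hgsymm : ∀ v : V, v ≠ 0 → ∀ u w : V, g v u w = g v w u)
    (hgpos : ∀ v : V, v ≠ 0 → ∀ u : V, u ≠ 0 → 0 < g v u u)
    (hpsd : ∀ v : V, v ≠ 0 → ∀ u : V, 0 ≤ B'' v u u)
    (halt : (∀ v : V, 0 ≤ B v) ∨ IsLinearMap ℝ B) :
    Continuous (Gfun Λ B F) ∧
    (∀ v : V, 0 ≤ Gfun Λ B F v) ∧
    (∀ l : ℝ, 0 < l → ∀ v : V, Gfun Λ B F (l • v) = l * Gfun Λ B F v) ∧
    (∀ v : V, v ≠ 0 → 0 < Gfun Λ B F v) ∧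
    ContDiffOn ℝ 2 (Gfun Λ B F) {0}ᶜ ∧
    ∃ (G2' : V → V →L[ℝ] ℝ) (G2'' : V → V →L[ℝ] V →L[ℝ] ℝ),
      (∀ v : V, v ≠ 0 → HasFDerivAt (fun w => (Gfun Λ B F w) ^ 2) (G2' v) v) ∧
      (∀ v : V, v ≠ 0 → HasFDerivAt G2' (G2'' v) v) ∧
      (∀ v : V, v ≠ 0 → ∀ u : V, u ≠ 0 → 0 < G2'' v u u) := by
  have hnn : ∀ v, 0 ≤ B v ^ 2 + Λ * F v ^ 2 := fun v => by positivity
  have hpos : ∀ v, v ≠ 0 → 0 < B v ^ 2 + Λ * F v ^ 2 := fun v hv => by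
    have := hFpos v hv
    positivity
  have hsq : (fun w => Gfun Λ B F w ^ 2) = fun w => B w ^ 2 + Λ * F w ^ 2 :=
    funext fun w => Real.sq_sqrt (hnn w)
  have hd1 : ∀ v : V, v ≠ 0 → HasFDerivAt (fun w => B w ^ 2 + Λ * F w ^ 2)
      ((2 : ℝ) • B v • B' v + Λ • F2' v) v := fun v hv => by
    refine (((hB' v hv).pow 2).add ((hF2' v hv).const_mul Λ)).congr_fderiv ?_
    ext u
    simp [mul_assoc]
  have hd2 : ∀ v : V, v ≠ 0 → HasFDerivAt (fun w => (2 : ℝ) • B w • B' w + Λ • F2' w)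
      ((2 : ℝ) • (B v • B'' v + (B' v).smulRight (B' v)) + Λ • (2 : ℝ) • g v) v := fun v hv =>
    (((hB' v hv).smul (hB'' v hv)).const_smul (2 : ℝ)).add ((hg v hv).const_smul Λ)
  have hB'cont : ContinuousOn B' {0}ᶜ := fun v hv =>
    (hB'' v hv).continuousAt.continuousWithinAt
  have hsmulRight : ContinuousOn (fun v => (B' v).smulRight (B' v)) {0}ᶜ :=
    ((ContinuousLinearMap.smulRightL ℝ V (V →L[ℝ] ℝ)).continuous.comp_continuousOn
      hB'cont).clm_apply hB'cont
  have hcont2 : ContinuousOn (fun v => (2 : ℝ) • (B v • B'' v + (B' v).smulRight (B' v)) +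
      Λ • (2 : ℝ) • g v) {0}ᶜ := by
    have hadd : ContinuousAdd (V →L[ℝ] V →L[ℝ] ℝ) :=
      @IsTopologicalAddGroup.toContinuousAdd (V →L[ℝ] V →L[ℝ] ℝ) _ _
        (@SeminormedAddCommGroup.toIsTopologicalAddGroup (V →L[ℝ] V →L[ℝ] ℝ) _)
    have h1 := ((hBcont.continuousOn.smul hB''cont).add hsmulRight).const_smul (2 : ℝ)
    have h2 := (hgcont.const_smul (2 : ℝ)).const_smul Λ
    exact h1.add h2
  have hBB : ∀ v : V, v ≠ 0 → ∀ u : V, 0 ≤ B v * B'' v u u := fun v hv u => by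
    rcases halt with h | h
    · exact mul_nonneg (h v) (hpsd v hv u)
    · simp [h.second_fderiv_eq_zero hB' hv (hB'' v hv)]
  refine ⟨?_, fun v => Real.sqrt_nonneg _, fun l hl v => ?_,
    fun v hv => Real.sqrt_pos.2 (hpos v hv), ?_, _, _, hsq ▸ hd1, hd2, fun v hv u hu => ?_⟩
  · unfold Gfun
    fun_prop
  · simp only [Gfun, hBhom l hl, hFhom l hl]
    rw [show (l * B v) ^ 2 + Λ * (l * F v) ^ 2 = l ^ 2 * (B v ^ 2 + Λ * F v ^ 2) by ring,
      Real.sqrt_mul (sq_nonneg l), Real.sqrt_sq hl.le]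
  · exact (contDiffOn_two_of_hasFDerivAt isOpen_compl_singleton hd1 hd2 hcont2).sqrt
      fun v hv => (hpos v hv).ne'
  · have h1 := hBB v hv u
    have h2 := mul_pos hΛ (hgpos v hv u hu)
    simp only [add_apply, smul_apply,
      ContinuousLinearMap.smulRight_apply, smul_eq_mul]
    nlinarith [mul_self_nonneg (B' v u)]
end

section
/- Let (τ,v) ∈ ℝ × V with (τ,v) ≠ (0,0). If τ > 0, then L(τ,v) ≤ 0 if and only if τ ≥ F_B(v); if τ < 0, then L(τ,v) ≤ 0 if and only if τ ≤ −F_B⁻(v). Equivalently, a vector (τ,v) with τ > 0 (resp. τ < 0) is a causal vector of L (i.e. L(τ,v) ≤ 0) if and only if it is a causal future-pointing (resp. past-pointing) vector of the static Lorentz–Finsler function L_B(τ,v) := −τ² + F_B(v)² (resp. L_{B⁻}(τ,v) := −τ² + F_B⁻(v)²). -/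
/-- The Fermat metric `F_B := B/Λ + √(B²/Λ² + F²/Λ)`. -/
noncomputable def fermatFB {V : Type*} (Λ : ℝ) (B F : V → ℝ) (v : V) : ℝ :=
  B v / Λ + Real.sqrt ((B v) ^ 2 / Λ ^ 2 + (F v) ^ 2 / Λ)

/-- The reverse Fermat metric `F_B⁻ := −B/Λ + √(B²/Λ² + F²/Λ)`. -/
noncomputable def fermatFBrev {V : Type*} (Λ : ℝ) (B F : V → ℝ) (v : V) : ℝ :=
  -(B v) / Λ + Real.sqrt ((B v) ^ 2 / Λ ^ 2 + (F v) ^ 2 / Λ)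

theorem mul_nonpos_iff_nonpos_of_pos {a b : ℝ} (ha : 0 < a) : a * b ≤ 0 ↔ b ≤ 0 := by
  rw [← not_lt, mul_pos_iff_of_pos_left ha, not_lt]

theorem fermatFB_nonneg {V : Type*} {Λ : ℝ} (hΛ : 0 < Λ) (B F : V → ℝ) (v : V) :
    0 ≤ fermatFB Λ B F v := by
  have h : |B v / Λ| ≤ Real.sqrt ((B v) ^ 2 / Λ ^ 2 + (F v) ^ 2 / Λ) := by
    apply Real.abs_le_sqrt
    rw [div_pow]
    have : 0 ≤ (F v) ^ 2 / Λ := by positivity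
    linarith
  unfold fermatFB
  linarith [neg_abs_le (B v / Λ)]

theorem fermatFBrev_eq_fermatFB_neg {V : Type*} (Λ : ℝ) (B F : V → ℝ) (v : V) :
    fermatFBrev Λ B F v = fermatFB Λ (-B) F v := by
  simp [fermatFB, fermatFBrev]

theorem fermatFBrev_nonneg {V : Type*} {Λ : ℝ} (hΛ : 0 < Λ) (B F : V → ℝ) (v : V) :
    0 ≤ fermatFBrev Λ B F v :=
  fermatFBrev_eq_fermatFB_neg Λ B F v ▸ fermatFB_nonneg hΛ (-B) F v

/-- `F_B` and `-F_B⁻` are the two roots of `τ ↦ -Λτ² + 2Bτ + F²`. -/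
theorem quadratic_eq_fermat_mul {V : Type*} {Λ : ℝ} (hΛ : 0 < Λ) (B F : V → ℝ) (τ : ℝ) (v : V) :
    -Λ * τ ^ 2 + 2 * B v * τ + (F v) ^ 2 =
      Λ * ((fermatFB Λ B F v - τ) * (τ + fermatFBrev Λ B F v)) := by
  have hs : Real.sqrt ((B v) ^ 2 / Λ ^ 2 + (F v) ^ 2 / Λ) ^ 2 =
      (B v) ^ 2 / Λ ^ 2 + (F v) ^ 2 / Λ := Real.sq_sqrt (by positivity)
  have hF : (F v) ^ 2 = Λ * ((F v) ^ 2 / Λ) := by field_simp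
  have hB : B v = Λ * (B v / Λ) := by field_simp
  unfold fermatFB fermatFBrev
  rw [← div_pow] at hs ⊢
  rw [neg_div]
  linear_combination hF + 2 * τ * hB - Λ * hs

/-- a nonzero vector `(τ,v)` with `τ > 0` (resp. `τ < 0`) is causal for `L`
(`L(τ,v) ≤ 0`) iff `τ ≥ F_B(v)` (resp. `τ ≤ −F_B⁻(v)`), i.e. iff it is a causal
future-pointing (resp. past-pointing) vector of the static Lorentz–Finsler function
`L_B(τ,v) = −τ² + F_B(v)²` (resp. `L_{B⁻}(τ,v) = −τ² + F_B⁻(v)²`). -/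
theorem causal_iff_fermat
    {V : Type*} [NormedAddCommGroup V] [NormedSpace ℝ V] [FiniteDimensional ℝ V]
    (Λ : ℝ) (hΛ : 0 < Λ)
    (B : V → ℝ) (hBcont : Continuous B)
    (hBhom : ∀ l : ℝ, 0 < l → ∀ v, B (l • v) = l * B v)
    (F : V → ℝ) (hFcont : Continuous F) (hFnonneg : ∀ v, 0 ≤ F v)
    (hFhom : ∀ l : ℝ, 0 < l → ∀ v, F (l • v) = l * F v)
    (hFpos : ∀ v : V, v ≠ 0 → 0 < F v)
    (L : ℝ × V → ℝ)
    (hL : ∀ (τ : ℝ) (v : V), L (τ, v) = -Λ * τ ^ 2 + 2 * B v * τ + (F v) ^ 2) :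
    ∀ (τ : ℝ) (v : V), (τ, v) ≠ ((0 : ℝ), (0 : V)) →
      (0 < τ →
        ((L (τ, v) ≤ 0 ↔ fermatFB Λ B F v ≤ τ) ∧
          (L (τ, v) ≤ 0 ↔ -τ ^ 2 + (fermatFB Λ B F v) ^ 2 ≤ 0))) ∧
      (τ < 0 →
        ((L (τ, v) ≤ 0 ↔ τ ≤ -fermatFBrev Λ B F v) ∧
          (L (τ, v) ≤ 0 ↔ -τ ^ 2 + (fermatFBrev Λ B F v) ^ 2 ≤ 0))) := by
  intro τ v _
  have hf := fermatFB_nonneg hΛ B F v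
  have hr := fermatFBrev_nonneg hΛ B F v
  rw [hL, quadratic_eq_fermat_mul hΛ, mul_nonpos_iff_nonpos_of_pos hΛ]
  refine ⟨fun hτ => ?_, fun hτ => ?_⟩
  · have key : (fermatFB Λ B F v - τ) * (τ + fermatFBrev Λ B F v) ≤ 0 ↔
        fermatFB Λ B F v ≤ τ := by
      rw [mul_comm, mul_nonpos_iff_nonpos_of_pos (by linarith), sub_nonpos]
    refine ⟨key, key.trans ?_⟩
    rw [neg_add_nonpos_iff, pow_le_pow_iff_left₀ hf hτ.le two_ne_zero]
  · have key : (fermatFB Λ B F v - τ) * (τ + fermatFBrev Λ B F v) ≤ 0 ↔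
        τ ≤ -fermatFBrev Λ B F v := by
      rw [mul_nonpos_iff_nonpos_of_pos (by linarith), ← le_neg_iff_add_nonpos_right]
    refine ⟨key, key.trans ?_⟩
    rw [neg_add_nonpos_iff, ← neg_sq τ, pow_le_pow_iff_left₀ hr (by linarith) two_ne_zero,
      le_neg]
end

section
/- The second derivative of H_α at every v ≠ 0 is a positive definite bilinear form on V. Similarly, if instead (∂²B)_v is negative semi-definite for all v ≠ 0, B(v) ≤ 0 for all v, and α ≥ 0, then the second derivative of H_α at every v ≠ 0 is positive definite. -/
/-- `H_α := −αB/Λ + ½(B²/Λ + F²)`. -/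
noncomputable def HAlpha {V : Type*} (Λ α : ℝ) (B F : V → ℝ) (v : V) : ℝ :=
  -α * B v / Λ + (1 / 2) * ((B v) ^ 2 / Λ + (F v) ^ 2)

theorem hasFDerivAt_HAlpha {V : Type*} [NormedAddCommGroup V] [NormedSpace ℝ V] {Λ α : ℝ}
    {B F : V → ℝ} {v : V} {b f : V →L[ℝ] ℝ} (hB : HasFDerivAt B b v)
    (hF : HasFDerivAt (fun w => (F w) ^ 2) f v) :
    HasFDerivAt (HAlpha Λ α B F) (((B v - α) / Λ) • b + (1 / 2 : ℝ) • f) v := by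
  have h := ((hB.const_mul (-α / Λ)).add ((hB.mul hB).const_mul (1 / 2 / Λ))).add
    (hF.const_mul (1 / 2))
  refine (h.congr_fderiv ?_).congr_of_eventuallyEq (.of_forall fun w => ?_)
  · ext u
    simp only [add_apply, smul_apply, smul_eq_mul]
    ring
  · simp only [HAlpha, Pi.add_apply, Pi.mul_apply]
    ring

theorem hasFDerivAt_smul_add_half {V : Type*} [NormedAddCommGroup V] [NormedSpace ℝ V] {Λ α : ℝ}
    {B : V → ℝ} {B' f : V → V →L[ℝ] ℝ} {v : V} {b'' q : V →L[ℝ] V →L[ℝ] ℝ}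
    (hB : HasFDerivAt B (B' v) v) (hB' : HasFDerivAt B' b'' v)
    (hf : HasFDerivAt f ((2 : ℝ) • q) v) :
    HasFDerivAt (fun w => ((B w - α) / Λ) • B' w + (1 / 2 : ℝ) • f w)
      (((B v - α) / Λ) • b'' + (Λ⁻¹ • B' v).smulRight (B' v) + q) v := by
  have hc : HasFDerivAt (fun w => (B w - α) / Λ) (Λ⁻¹ • B' v) v := by
    simpa only [div_eq_inv_mul] using (hB.sub_const α).const_mul Λ⁻¹
  refine ((hc.smul hB').add (hf.const_smul (1 / 2 : ℝ))).congr_fderiv ?_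
  rw [smul_smul]
  norm_num

/-- If `(B - α) ∂²B` is positive semi-definite off `0`, then the second derivative of `HAlpha`
is positive definite there. -/
theorem HAlpha_second_derivative_pos_of_nonneg {V : Type*} [NormedAddCommGroup V]
    [NormedSpace ℝ V] {Λ α : ℝ} (hΛ : 0 < Λ)
    {B : V → ℝ} {B' : V → V →L[ℝ] ℝ} {B'' : V → V →L[ℝ] V →L[ℝ] ℝ}
    (hB' : ∀ v : V, v ≠ 0 → HasFDerivAt B (B' v) v)
    (hB'' : ∀ v : V, v ≠ 0 → HasFDerivAt B' (B'' v) v)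
    {F : V → ℝ} {F2' : V → V →L[ℝ] ℝ} {g : V → V →L[ℝ] V →L[ℝ] ℝ}
    (hF2' : ∀ v : V, v ≠ 0 → HasFDerivAt (fun w => (F w) ^ 2) (F2' v) v)
    (hg : ∀ v : V, v ≠ 0 → HasFDerivAt F2' ((2 : ℝ) • g v) v)
    (hgpos : ∀ v : V, v ≠ 0 → ∀ u : V, u ≠ 0 → 0 < g v u u)
    (h : ∀ v : V, v ≠ 0 → ∀ u : V, 0 ≤ (B v - α) * B'' v u u) :
    ∃ (H' : V → V →L[ℝ] ℝ) (H'' : V → V →L[ℝ] V →L[ℝ] ℝ),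
      (∀ v : V, v ≠ 0 → HasFDerivAt (HAlpha Λ α B F) (H' v) v) ∧
      (∀ v : V, v ≠ 0 → HasFDerivAt H' (H'' v) v) ∧
      (∀ v : V, v ≠ 0 → ∀ u : V, u ≠ 0 → 0 < H'' v u u) := by
  refine ⟨_, _, fun v hv => hasFDerivAt_HAlpha (hB' v hv) (hF2' v hv),
    fun v hv => hasFDerivAt_smul_add_half (hB' v hv) (hB'' v hv) (hg v hv), fun v hv u hu => ?_⟩
  have h₁ : 0 ≤ (B v - α) * B'' v u u / Λ := div_nonneg (h v hv u) hΛ.le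
  have h₂ : 0 ≤ Λ⁻¹ * (B' v u * B' v u) :=
    mul_nonneg (inv_nonneg.2 hΛ.le) (mul_self_nonneg _)
  have h₃ := hgpos v hv u hu
  simp only [add_apply, smul_apply,
    ContinuousLinearMap.smulRight_apply, smul_eq_mul]
  rw [div_mul_eq_mul_div, mul_assoc]
  linarith

/-- if `(∂²B)` is positive semi-definite off 0, `B ≥ 0` and `α ≤ 0`
(resp. negative semi-definite, `B ≤ 0`, `α ≥ 0`), then the second derivative of
`H_α` at every `v ≠ 0` is positive definite. -/
theorem HAlpha_second_derivative_positive_definite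
    {V : Type*} [NormedAddCommGroup V] [NormedSpace ℝ V] [FiniteDimensional ℝ V]
    (Λ : ℝ) (hΛ : 0 < Λ)
    (B : V → ℝ) (B' : V → V →L[ℝ] ℝ) (B'' : V → V →L[ℝ] V →L[ℝ] ℝ)
    (hBcont : Continuous B)
    (hBhom : ∀ l : ℝ, 0 < l → ∀ v, B (l • v) = l * B v)
    (hB' : ∀ v : V, v ≠ 0 → HasFDerivAt B (B' v) v)
    (hB'' : ∀ v : V, v ≠ 0 → HasFDerivAt B' (B'' v) v)
    (hB''cont : ContinuousOn B'' {0}ᶜ)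
    (hB''symm : ∀ v : V, v ≠ 0 → ∀ u w : V, B'' v u w = B'' v w u)
    (F : V → ℝ) (F2' : V → V →L[ℝ] ℝ) (g : V → V →L[ℝ] V →L[ℝ] ℝ)
    (hFcont : Continuous F) (hFnonneg : ∀ v, 0 ≤ F v)
    (hFhom : ∀ l : ℝ, 0 < l → ∀ v, F (l • v) = l * F v)
    (hFpos : ∀ v : V, v ≠ 0 → 0 < F v)
    (hF2' : ∀ v : V, v ≠ 0 → HasFDerivAt (fun w => (F w) ^ 2) (F2' v) v)
    (hg : ∀ v : V, v ≠ 0 → HasFDerivAt F2' ((2 : ℝ) • g v) v)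
    (hgcont : ContinuousOn g {0}ᶜ)
    (hgsymm : ∀ v : V, v ≠ 0 → ∀ u w : V, g v u w = g v w u)
    (hgpos : ∀ v : V, v ≠ 0 → ∀ u : V, u ≠ 0 → 0 < g v u u)
    (α : ℝ) :
    (((∀ v : V, v ≠ 0 → ∀ u : V, 0 ≤ B'' v u u) ∧ (∀ v : V, 0 ≤ B v) ∧ α ≤ 0) →
      ∃ (H' : V → V →L[ℝ] ℝ) (H'' : V → V →L[ℝ] V →L[ℝ] ℝ),
        (∀ v : V, v ≠ 0 → HasFDerivAt (HAlpha Λ α B F) (H' v) v) ∧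
        (∀ v : V, v ≠ 0 → HasFDerivAt H' (H'' v) v) ∧
        (∀ v : V, v ≠ 0 → ∀ u : V, u ≠ 0 → 0 < H'' v u u)) ∧
    (((∀ v : V, v ≠ 0 → ∀ u : V, B'' v u u ≤ 0) ∧ (∀ v : V, B v ≤ 0) ∧ 0 ≤ α) →
      ∃ (H' : V → V →L[ℝ] ℝ) (H'' : V → V →L[ℝ] V →L[ℝ] ℝ),
        (∀ v : V, v ≠ 0 → HasFDerivAt (HAlpha Λ α B F) (H' v) v) ∧
        (∀ v : V, v ≠ 0 → HasFDerivAt H' (H'' v) v) ∧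
        (∀ v : V, v ≠ 0 → ∀ u : V, u ≠ 0 → 0 < H'' v u u)) := by
  refine ⟨fun ⟨hpos, hB, hα⟩ => ?_, fun ⟨hneg, hB, hα⟩ => ?_⟩
  · exact HAlpha_second_derivative_pos_of_nonneg hΛ hB' hB'' hF2' hg hgpos fun v hv u =>
      mul_nonneg (by linarith [hB v]) (hpos v hv u)
  · exact HAlpha_second_derivative_pos_of_nonneg hΛ hB' hB'' hF2' hg hgpos fun v hv u =>
      mul_nonneg_of_nonpos_of_nonpos (by linarith [hB v]) (hneg v hv u)
end
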